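/- For each i ∈ {1,2,3}, Ext¹_A(M, S_i) ≠ 0, where M := A ⊕ D(A). Consequently, no simple A-module belongs to {X ∈ mod-A : Ext¹_A(M,X) = 0}. -/

import Mathlib

/-!
We formalize statements about the algebra `A = kQ/J²`, where `Q` is the quiver
`1 ⇄ 2 ⇄ 3` and `J` is the arrow ideal of the path algebra `kQ`.
The algebra `A` is presented by generators and relations as a quotient of the
free algebra on three vertex idempotents and four arrows.
Right `A`-modules are treated as left modules over `Aᵐᵒᵖ`.
-/

open CategoryTheory Opposite

/-- Generators of the path algebra `kQ`: three vertex idempotents `e i`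
and four arrows `ar a`, where the arrows of `Q` are
`α : 1 → 2`, `β : 2 → 1`, `γ : 2 → 3`, `δ : 3 → 2`. -/
inductive QGen : Type
  | e : Fin 3 → QGen
  | ar : Fin 4 → QGen

/-- The sources of the four arrows `α, β, γ, δ` (vertices `1,2,3` are `0,1,2 : Fin 3`). -/
def arrowSrc : Fin 4 → Fin 3 := ![0, 1, 1, 2]

/-- The targets of the four arrows `α, β, γ, δ`. -/
def arrowTgt : Fin 4 → Fin 3 := ![1, 0, 2, 1]

/-- The defining relations of `A = kQ/J²`: the `e i` are orthogonal idempotents summing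
to `1`, the arrows are compatible with their sources and targets, and any product of
two arrows vanishes (`J² = 0`). -/
inductive ARel (k : Type) [Field k] : FreeAlgebra k QGen → FreeAlgebra k QGen → Prop
  | idem (i j : Fin 3) :
      ARel k (FreeAlgebra.ι k (QGen.e i) * FreeAlgebra.ι k (QGen.e j))
        (if i = j then FreeAlgebra.ι k (QGen.e i) else 0)
  | sum : ARel k
      (FreeAlgebra.ι k (QGen.e 0) + FreeAlgebra.ι k (QGen.e 1) + FreeAlgebra.ι k (QGen.e 2)) 1
  | src (a : Fin 4) :
      ARel k (FreeAlgebra.ι k (QGen.e (arrowSrc a)) * FreeAlgebra.ι k (QGen.ar a))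
        (FreeAlgebra.ι k (QGen.ar a))
  | tgt (a : Fin 4) :
      ARel k (FreeAlgebra.ι k (QGen.ar a) * FreeAlgebra.ι k (QGen.e (arrowTgt a)))
        (FreeAlgebra.ι k (QGen.ar a))
  | radsq (a b : Fin 4) :
      ARel k (FreeAlgebra.ι k (QGen.ar a) * FreeAlgebra.ι k (QGen.ar b)) 0

/-- The algebra `A = kQ/J²`. -/
abbrev AlgA (k : Type) [Field k] : Type := RingQuot (ARel k)

/-- Right `A`-modules are left modules over `Aop k = Aᵐᵒᵖ`. -/
abbrev Aop (k : Type) [Field k] : Type := (AlgA k)ᵐᵒᵖ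

/-- The algebra homomorphism `A → k` corresponding to the vertex `i`. -/
noncomputable def simpleAlgHom (k : Type) [Field k] (i : Fin 3) : AlgA k →ₐ[k] k :=
  RingQuot.liftAlgHom k
    ⟨FreeAlgebra.lift k (fun g => match g with
        | QGen.e j => if j = i then (1 : k) else 0
        | QGen.ar _ => 0), by
      intro _x _y h
      induction h with
      | idem i j =>
          simp only [map_mul, FreeAlgebra.lift_ι_apply, apply_ite, map_zero]
          split_ifs <;> simp_all
      | sum =>
          simp only [map_add, map_one, FreeAlgebra.lift_ι_apply]
          fin_cases i <;> simp
      | src a => simp [FreeAlgebra.lift_ι_apply]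
      | tgt a => simp [FreeAlgebra.lift_ι_apply]
      | radsq a b => simp [FreeAlgebra.lift_ι_apply]⟩

/-- The ring homomorphism `Aᵐᵒᵖ → k` corresponding to the vertex `i`. -/
noncomputable def simpleRingHom (k : Type) [Field k] (i : Fin 3) : Aop k →+* k :=
  RingHom.fromOpposite (simpleAlgHom k i).toRingHom (fun _ _ => mul_comm _ _)

/-- The simple right `A`-module `S_{i+1}` at the vertex `i` (one-dimensional over `k`,
with `e i` acting as the identity and all arrows acting by zero).
So `SimpleS k 0 = S₁`, `SimpleS k 1 = S₂` and `SimpleS k 2 = S₃`. -/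
def SimpleS (k : Type) [Field k] (_i : Fin 3) : Type := k

instance (k : Type) [Field k] (i : Fin 3) : AddCommGroup (SimpleS k i) :=
  inferInstanceAs (AddCommGroup k)

instance (k : Type) [Field k] (i : Fin 3) : Module k (SimpleS k i) :=
  inferInstanceAs (Module k k)

noncomputable instance (k : Type) [Field k] (i : Fin 3) : Module (Aop k) (SimpleS k i) :=
  Module.compHom (SimpleS k i) (simpleRingHom k i)

/-- The underlying type of `D(A) = Hom_k(A, k)`. -/
abbrev DualA (k : Type) [Field k] : Type := AlgA k →ₗ[k] k

/-- The right `A`-module structure on `D(A)`: `(φ · a) x = φ (a * x)`. -/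
noncomputable instance (k : Type) [Field k] : Module (Aop k) (DualA k) where
  smul a φ := φ.comp (LinearMap.mulLeft k a.unop)
  one_smul φ := by
    show φ.comp (LinearMap.mulLeft k ((1 : Aop k).unop)) = φ
    ext x; simp
  mul_smul a b φ := by
    show φ.comp (LinearMap.mulLeft k ((a * b).unop)) =
      (φ.comp (LinearMap.mulLeft k b.unop)).comp (LinearMap.mulLeft k a.unop)
    ext x; simp [mul_assoc]
  smul_zero a := by
    show (0 : DualA k).comp (LinearMap.mulLeft k a.unop) = 0
    ext x; simp
  smul_add a φ ψ := by
    show (φ + ψ).comp (LinearMap.mulLeft k a.unop) =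
      φ.comp (LinearMap.mulLeft k a.unop) + ψ.comp (LinearMap.mulLeft k a.unop)
    ext x; simp
  add_smul a b φ := by
    show φ.comp (LinearMap.mulLeft k ((a + b).unop)) =
      φ.comp (LinearMap.mulLeft k a.unop) + φ.comp (LinearMap.mulLeft k b.unop)
    ext x; simp [add_mul]
  zero_smul φ := by
    show φ.comp (LinearMap.mulLeft k ((0 : Aop k).unop)) = 0
    ext x; simp

/-- The right `A`-module `M = A ⊕ D(A)`, where `A` carries the right regular
`A`-module structure. -/
abbrev MA (k : Type) [Field k] : Type := AlgA k × DualA k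

/-- `X` belongs to `add M`: `X` is (isomorphic to) a direct summand of `Mⁿ` for some `n`. -/
def InAdd (k : Type) [Field k] (M X : Type) [AddCommGroup M] [Module (Aop k) M]
    [AddCommGroup X] [Module (Aop k) X] : Prop :=
  ∃ (n : ℕ) (ι : X →ₗ[Aop k] (Fin n → M)) (π : (Fin n → M) →ₗ[Aop k] X),
    π.comp ι = LinearMap.id

/-- `Ext^i_A(X, Y)` for right `A`-modules `X` and `Y`, computed in the abelian
category of all right `A`-modules (which has the same `Ext` groups as `mod A`). -/
noncomputable def ExtA (k : Type) [Field k] (X Y : Type) [AddCommGroup X] [Module (Aop k) X]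
    [AddCommGroup Y] [Module (Aop k) Y] (i : ℕ) : Type :=
  ((Ext ℤ (ModuleCat (Aop k)) i).obj (op (ModuleCat.of (Aop k) X))).obj (ModuleCat.of (Aop k) Y)

/-- If `Ext¹(Z, X₁)` vanishes, every morphism from `Z` to the cokernel of a short exact
sequence starting at `X₁` lifts to the middle term. -/
theorem exists_lift_of_isZero_Ext_one
    {R C : Type*} [Ring R] [Category* C] [Abelian C] [Linear R C] [EnoughProjectives C]
    {S : ShortComplex C} (hS : S.ShortExact) {Z : C} (g : Z ⟶ S.X₃)
    (hZ : Limits.IsZero (((Ext R C 1).obj (op Z)).obj S.X₁)) :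
    ∃ s : Z ⟶ S.X₂, s ≫ S.g = g := by
  have := hS.mono_f
  have := hS.epi_g
  let P := projectiveResolution Z
  have hE : (P.complex.linearYonedaObj R S.X₁).ExactAt 1 := by
    rw [HomologicalComplex.exactAt_iff_isZero_homology]
    exact hZ.of_iso (P.isoExt 1 S.X₁).symm
  rw [HomologicalComplex.exactAt_iff' _ 0 1 2 (by simp) (by simp),
    ShortComplex.moduleCat_exact_iff] at hE
  have hlift (b : P.complex.X 1 ⟶ S.X₁) (hb : P.complex.d 2 1 ≫ b = 0) :
      ∃ c : P.complex.X 0 ⟶ S.X₁, P.complex.d 1 0 ≫ c = b := hE b hb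
  obtain ⟨π, hπ, hdπ, hdesc⟩ : ∃ π : P.complex.X 0 ⟶ Z, Epi π ∧ P.complex.d 1 0 ≫ π = 0 ∧
      ∀ u : P.complex.X 0 ⟶ S.X₂, P.complex.d 1 0 ≫ u = 0 → ∃ s : Z ⟶ S.X₂, π ≫ s = u :=
    ⟨P.π.f 0, inferInstanceAs (Epi (P.π.f 0)), P.complex_d_comp_π_f_zero, fun u hu =>
      ⟨P.isColimitCokernelCofork.desc (Limits.CokernelCofork.ofπ u hu),
        P.isColimitCokernelCofork.fac _ Limits.WalkingParallelPair.one⟩⟩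
  let a : P.complex.X 0 ⟶ S.X₂ := Projective.factorThru (π ≫ g) S.g
  have ha : a ≫ S.g = π ≫ g := Projective.factorThru_comp _ _
  have hd : (P.complex.d 1 0 ≫ a) ≫ S.g = 0 := by
    rw [Category.assoc, ha, ← Category.assoc, hdπ, Limits.zero_comp]
  let b : P.complex.X 1 ⟶ S.X₁ := hS.exact.lift (P.complex.d 1 0 ≫ a) hd
  have hb : b ≫ S.f = P.complex.d 1 0 ≫ a := hS.exact.lift_f _ _
  have hb0 : P.complex.d 2 1 ≫ b = 0 := by
    rw [← cancel_mono S.f, Category.assoc, hb, ← Category.assoc, P.complex.d_comp_d,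
      Limits.zero_comp, Limits.zero_comp]
  obtain ⟨c, hc⟩ := hlift b hb0
  obtain ⟨s, hs⟩ := hdesc (a - c ≫ S.f) (by
    rw [Preadditive.comp_sub, ← Category.assoc, hc, hb, sub_self])
  refine ⟨s, ?_⟩
  rw [← cancel_epi π, ← Category.assoc, hs, Preadditive.sub_comp, ha, Category.assoc, S.zero,
    Limits.comp_zero, sub_zero]

section AlgA

variable (k : Type) [Field k]

/-- The class of a generator in `A`. -/
noncomputable def genA (g : QGen) : AlgA k := RingQuot.mkAlgHom k (ARel k) (FreeAlgebra.ι k g)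

variable {k}

theorem AlgA.induction {motive : AlgA k → Prop}
    (algebraMap : ∀ c : k, motive (algebraMap k (AlgA k) c))
    (gen : ∀ g, motive (genA k g))
    (mul : ∀ a b, motive a → motive b → motive (a * b))
    (add : ∀ a b, motive a → motive b → motive (a + b)) (a : AlgA k) : motive a := by
  obtain ⟨a, rfl⟩ := RingQuot.mkAlgHom_surjective k (ARel k) a
  induction a with
  | grade0 c => simpa using algebraMap c
  | grade1 g => exact gen g
  | mul a b ha hb => simpa using mul _ _ ha hb
  | add a b ha hb => simpa using add _ _ ha hb

theorem genA_e_mul_e (i j : Fin 3) :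
    genA k (.e i) * genA k (.e j) = if i = j then genA k (.e i) else 0 := by
  have := RingQuot.mkAlgHom_rel k (ARel.idem (k := k) i j)
  split_ifs at this ⊢ <;> simpa [genA] using this

theorem genA_e_sum : genA k (.e 0) + genA k (.e 1) + genA k (.e 2) = 1 := by
  simpa [genA] using RingQuot.mkAlgHom_rel k (ARel.sum (k := k))

theorem genA_src_mul (a : Fin 4) : genA k (.e (arrowSrc a)) * genA k (.ar a) = genA k (.ar a) := by
  simpa [genA] using RingQuot.mkAlgHom_rel k (ARel.src (k := k) a)

theorem genA_mul_tgt (a : Fin 4) : genA k (.ar a) * genA k (.e (arrowTgt a)) = genA k (.ar a) := by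
  simpa [genA] using RingQuot.mkAlgHom_rel k (ARel.tgt (k := k) a)

theorem genA_ar_mul_ar (a b : Fin 4) : genA k (.ar a) * genA k (.ar b) = 0 := by
  simpa [genA] using RingQuot.mkAlgHom_rel k (ARel.radsq (k := k) a b)

@[simp]
theorem simpleAlgHom_genA_e (i j : Fin 3) :
    simpleAlgHom k i (genA k (.e j)) = if j = i then 1 else 0 := by
  simp [simpleAlgHom, genA, FreeAlgebra.lift_ι_apply]

@[simp]
theorem simpleAlgHom_genA_ar (i : Fin 3) (a : Fin 4) :
    simpleAlgHom k i (genA k (.ar a)) = 0 := by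
  simp [simpleAlgHom, genA, FreeAlgebra.lift_ι_apply]

theorem mul_genA_ar (p : Fin 4) (a : AlgA k) :
    a * genA k (.ar p) = simpleAlgHom k (arrowSrc p) a • genA k (.ar p) := by
  induction a using AlgA.induction with
  | algebraMap c => simp [Algebra.smul_def]
  | gen g =>
    cases g with
    | e j =>
      rw [← genA_src_mul p, ← mul_assoc, genA_e_mul_e, simpleAlgHom_genA_e]
      split_ifs with h
      · rw [h, one_smul]
      · simp
    | ar b => simp [genA_ar_mul_ar]
  | mul a b ha hb => rw [mul_assoc, hb, mul_smul_comm, ha, smul_smul, map_mul, mul_comm]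
  | add a b ha hb => rw [add_mul, ha, hb, map_add, add_smul]

theorem genA_ar_mul (q : Fin 4) (a : AlgA k) :
    genA k (.ar q) * a = simpleAlgHom k (arrowTgt q) a • genA k (.ar q) := by
  induction a using AlgA.induction with
  | algebraMap c => rw [AlgHom.commutes, Algebra.smul_def, ← Algebra.commutes]; rfl
  | gen g =>
    cases g with
    | e j =>
      rw [← genA_mul_tgt q, mul_assoc, genA_e_mul_e, simpleAlgHom_genA_e]
      split_ifs with h h' h'
      · simp
      · exact absurd h.symm h'
      · exact absurd h'.symm h
      · simp
    | ar b => simp [genA_ar_mul_ar]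
  | mul a b ha hb => rw [← mul_assoc, ha, smul_mul_assoc, hb, smul_smul, map_mul]
  | add a b ha hb => rw [mul_add, ha, hb, map_add, add_smul]

variable (k)

/-- The two-dimensional representation of `A` supported on the arrow `q`. -/
noncomputable def arrowRep (q : Fin 4) : AlgA k →ₐ[k] Matrix (Fin 2) (Fin 2) k :=
  RingQuot.liftAlgHom k
    ⟨FreeAlgebra.lift k (fun g => match g with
        | QGen.e j => !![if j = arrowSrc q then 1 else 0, 0; 0, if j = arrowTgt q then 1 else 0]
        | QGen.ar a => if a = q then !![0, 1; 0, 0] else 0), by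
      intro _ _ h
      induction h with
      | idem i j =>
        simp only [map_mul, FreeAlgebra.lift_ι_apply]
        by_cases hij : i = j
        · subst hij
          rw [if_pos rfl, FreeAlgebra.lift_ι_apply]
          ext m n
          fin_cases m <;> fin_cases n <;> simp [Matrix.mul_apply]
        · rw [if_neg hij, map_zero]
          ext m n
          fin_cases m <;> fin_cases n <;> simp [Matrix.mul_apply] <;>
            (intro h1 h2; exact absurd (h2.trans h1.symm) hij)
      | sum =>
        simp only [map_add, map_one, FreeAlgebra.lift_ι_apply]
        generalize arrowSrc q = i, arrowTgt q = j
        ext m n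
        fin_cases m <;> fin_cases n <;> fin_cases i <;> fin_cases j <;> simp
      | src a =>
        simp only [map_mul, FreeAlgebra.lift_ι_apply]
        by_cases h : a = q
        · subst h
          ext m n
          fin_cases m <;> fin_cases n <;> simp [Matrix.mul_apply]
        · simp only [if_neg h, mul_zero]
      | tgt a =>
        simp only [map_mul, FreeAlgebra.lift_ι_apply]
        by_cases h : a = q
        · subst h
          ext m n
          fin_cases m <;> fin_cases n <;> simp [Matrix.mul_apply]
        · simp only [if_neg h, zero_mul]
      | radsq a b =>
        simp only [map_mul, FreeAlgebra.lift_ι_apply, map_zero]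
        by_cases h : a = q
        · by_cases h' : b = q
          · ext m n
            fin_cases m <;> fin_cases n <;> simp [h, h', Matrix.mul_apply]
          · simp only [if_neg h', mul_zero]
        · simp only [if_neg h, zero_mul]⟩

/-- The coefficient of the arrow `q`, as a linear form on `A`. -/
noncomputable def arrowCoeff (q : Fin 4) : DualA k :=
  Matrix.entryLinearMap k k 0 1 ∘ₗ (arrowRep k q).toLinearMap

variable {k}

theorem arrowRep_apply (q : Fin 4) (a : AlgA k) :
    arrowRep k q a = !![simpleAlgHom k (arrowSrc q) a, arrowCoeff k q a;
      0, simpleAlgHom k (arrowTgt q) a] := by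
  induction a using AlgA.induction with
  | algebraMap c =>
    ext m n
    fin_cases m <;> fin_cases n <;> simp [arrowCoeff, Matrix.algebraMap_matrix_apply]
  | gen g =>
    ext m n
    cases g with
    | e j =>
      fin_cases m <;> fin_cases n <;>
        simp [arrowCoeff, arrowRep, genA, simpleAlgHom, FreeAlgebra.lift_ι_apply]
    | ar a =>
      by_cases h : a = q <;> fin_cases m <;> fin_cases n <;>
        simp [h, arrowCoeff, arrowRep, genA, simpleAlgHom, FreeAlgebra.lift_ι_apply]
  | mul a b ha hb =>
    have h : arrowCoeff k q (a * b) = (arrowRep k q a * arrowRep k q b) 0 1 := by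
      rw [← map_mul]; rfl
    rw [h, map_mul, ha, hb]
    ext m n
    fin_cases m <;> fin_cases n <;> simp [Matrix.mul_apply]
  | add a b ha hb =>
    ext m n
    fin_cases m <;> fin_cases n <;> simp [ha, hb]

theorem arrowCoeff_mul (q : Fin 4) (a b : AlgA k) :
    arrowCoeff k q (a * b) = simpleAlgHom k (arrowSrc q) a * arrowCoeff k q b +
      arrowCoeff k q a * simpleAlgHom k (arrowTgt q) b := by
  have h := congrFun (congrFun (map_mul (arrowRep k q) a b) 0) 1
  rw [arrowRep_apply, arrowRep_apply, arrowRep_apply] at h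
  simpa using h

@[simp]
theorem arrowCoeff_genA_ar (q a : Fin 4) :
    arrowCoeff k q (genA k (.ar a)) = if a = q then 1 else 0 := by
  by_cases h : a = q <;> simp [h, arrowCoeff, arrowRep, genA, FreeAlgebra.lift_ι_apply]

@[simp]
theorem arrowCoeff_one (q : Fin 4) : arrowCoeff k q 1 = 0 := by
  simp [arrowCoeff]

theorem dualA_smul_apply (a : Aop k) (φ : DualA k) (x : AlgA k) : (a • φ) x = φ (a.unop * x) := rfl

variable (k)

/-- The extension of `D(A)` by the simple module at the target of `q` given by the cocycle
`(φ, a) ↦ φ(p) q*(a)`, for arrows `p` and `q` with the same source. -/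
def ArrowExt (p q : Fin 4) (_h : arrowSrc p = arrowSrc q) : Type := DualA k × k

variable {p q : Fin 4} (h : arrowSrc p = arrowSrc q)

noncomputable instance : AddCommGroup (ArrowExt k p q h) :=
  inferInstanceAs (AddCommGroup (DualA k × k))

namespace ArrowExt

variable {k h}

/-- The component of an element of `ArrowExt` in `D(A)`. -/
def fst (x : ArrowExt k p q h) : DualA k := Prod.fst x

/-- The component of an element of `ArrowExt` in the simple module. -/
def snd (x : ArrowExt k p q h) : k := Prod.snd x

@[ext]
theorem ext {x y : ArrowExt k p q h} (h1 : x.fst = y.fst) (h2 : x.snd = y.snd) : x = y :=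
  Prod.ext h1 h2

noncomputable instance : SMul (Aop k) (ArrowExt k p q h) where
  smul a x := (a • x.fst, x.snd * simpleAlgHom k (arrowTgt q) a.unop +
    x.fst (genA k (.ar p)) * arrowCoeff k q a.unop)

@[simp]
theorem fst_smul (a : Aop k) (x : ArrowExt k p q h) : (a • x).fst = a • x.fst := rfl

@[simp]
theorem snd_smul (a : Aop k) (x : ArrowExt k p q h) :
    (a • x).snd = x.snd * simpleAlgHom k (arrowTgt q) a.unop +
      x.fst (genA k (.ar p)) * arrowCoeff k q a.unop := rfl

@[simp]
theorem fst_add (x y : ArrowExt k p q h) : (x + y).fst = x.fst + y.fst := rfl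

@[simp]
theorem snd_add (x y : ArrowExt k p q h) : (x + y).snd = x.snd + y.snd := rfl

@[simp]
theorem fst_zero : (0 : ArrowExt k p q h).fst = 0 := rfl

@[simp]
theorem snd_zero : (0 : ArrowExt k p q h).snd = 0 := rfl

noncomputable instance : Module (Aop k) (ArrowExt k p q h) where
  one_smul x := by ext1 <;> simp
  mul_smul a b x := by
    ext1
    · exact mul_smul a b x.fst
    · simp only [snd_smul, fst_smul, MulOpposite.unop_mul, map_mul, arrowCoeff_mul,
        dualA_smul_apply, mul_genA_ar, map_smul, smul_eq_mul, h]
      ring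
  smul_zero a := by ext1 <;> simp
  smul_add a x y := by
    ext1
    · simp
    · simp only [snd_smul, snd_add, fst_add, LinearMap.add_apply]
      ring
  add_smul a b x := by
    ext1
    · exact add_smul a b x.fst
    · simp only [snd_smul, snd_add, MulOpposite.unop_add, map_add]
      ring
  zero_smul x := by
    ext1
    · exact zero_smul (Aop k) x.fst
    · simp

variable (h)

/-- The inclusion of the simple submodule of `ArrowExt`. -/
noncomputable def inl : SimpleS k (arrowTgt q) →ₗ[Aop k] ArrowExt k p q h where
  toFun c := ((0 : DualA k), (c : k))
  map_add' _ _ := ArrowExt.ext (add_zero (0 : DualA k)).symm rfl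
  map_smul' a c := by
    refine ArrowExt.ext (smul_zero a).symm ?_
    exact (mul_comm _ _).trans ((add_zero _).symm.trans
      (congrArg _ (zero_mul (arrowCoeff k q a.unop)).symm))

/-- The projection of `ArrowExt` onto `D(A)`. -/
noncomputable def proj : ArrowExt k p q h →ₗ[Aop k] DualA k where
  toFun x := x.fst
  map_add' _ _ := rfl
  map_smul' _ _ := rfl

end ArrowExt

variable {k}

theorem ArrowExt.not_split (h' : p = q → ∃ r ≠ q, arrowTgt r = arrowTgt q)
    (s : DualA k →ₗ[Aop k] ArrowExt k p q h) (hs : ∀ φ, (s φ).fst = φ) : False := by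
  have key (r : Fin 4) (a : Fin 4) :
      (s (MulOpposite.op (genA k (.ar a)) • arrowCoeff k r)).snd =
        (if p = r then 1 else 0) * (if a = q then 1 else 0) := by
    rw [map_smul, ArrowExt.snd_smul]
    simp [hs]
  have hsm (r a : Fin 4) (x : AlgA k) : (MulOpposite.op (genA k (.ar a)) • arrowCoeff k r) x =
      (if a = r then 1 else 0) * simpleAlgHom k (arrowTgt a) x := by
    rw [dualA_smul_apply, MulOpposite.unop_op, genA_ar_mul, map_smul, arrowCoeff_genA_ar,
      smul_eq_mul, mul_comm]
  by_cases hpq : p = q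
  · obtain ⟨r, hr, hrt⟩ := h' hpq
    have he : MulOpposite.op (genA k (.ar r)) • arrowCoeff k r =
        MulOpposite.op (genA k (.ar q)) • arrowCoeff k q := by
      refine LinearMap.ext fun x => ?_
      rw [hsm, hsm, hrt, if_pos rfl, if_pos rfl]
    have h1 := key r r
    rw [he, key] at h1
    simp [hpq, hr] at h1
  · have h0 : MulOpposite.op (genA k (.ar q)) • arrowCoeff k p = 0 := by
      refine LinearMap.ext fun x => ?_
      rw [hsm, if_neg (Ne.symm hpq), zero_mul, LinearMap.zero_apply]
    have h1 := key p q
    rw [h0, map_zero] at h1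
    simp at h1

theorem nontrivial_ext_arrowTgt (h : arrowSrc p = arrowSrc q)
    (h' : p = q → ∃ r ≠ q, arrowTgt r = arrowTgt q) :
    Nontrivial (ExtA k (MA k) (SimpleS k (arrowTgt q)) 1) := by
  by_contra hn
  rw [not_nontrivial_iff_subsingleton] at hn
  have hw : ModuleCat.ofHom (ArrowExt.inl (k := k) h) ≫ ModuleCat.ofHom (ArrowExt.proj h) = 0 := by
    ext; rfl
  have hS : (ShortComplex.mk _ _ hw).ShortExact := by
    refine ShortComplex.ShortExact.mk' ?_ ?_ ?_
    · rw [ShortComplex.moduleCat_exact_iff]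
      intro x hx
      replace hx : x.1 = 0 := hx
      exact ⟨x.2, Prod.ext hx.symm rfl⟩
    · rw [ModuleCat.mono_iff_injective]
      intro c d hcd
      exact congrArg Prod.snd hcd
    · rw [ModuleCat.epi_iff_surjective]
      intro φ
      exact ⟨(φ, 0), rfl⟩
  obtain ⟨s, hs⟩ := exists_lift_of_isZero_Ext_one (R := ℤ) hS
    (ModuleCat.ofHom (LinearMap.snd (Aop k) (AlgA k) (DualA k)))
    (@ModuleCat.isZero_of_subsingleton _ _ _ hn)
  refine ArrowExt.not_split h h' (s.hom ∘ₗ LinearMap.inr (Aop k) (AlgA k) (DualA k)) fun φ => ?_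
  exact congrArg (fun f => f.hom ((0 : AlgA k), φ)) hs

theorem nontrivial_ext_simpleS (i : Fin 3) : Nontrivial (ExtA k (MA k) (SimpleS k i) 1) := by
  fin_cases i
  · exact nontrivial_ext_arrowTgt (p := 2) (q := 1) rfl (by decide)
  · exact nontrivial_ext_arrowTgt (p := 0) (q := 0) rfl (by decide)
  · exact nontrivial_ext_arrowTgt (p := 1) (q := 2) rfl (by decide)

/-- Every simple right `A`-module is isomorphic to one of the `S_i`. -/
theorem exists_simpleS_equiv (X : Type) [AddCommGroup X] [Module (Aop k) X]
    [IsSimpleModule (Aop k) X] : ∃ i : Fin 3, Nonempty (SimpleS k i ≃ₗ[Aop k] X) := by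
  have hX : ∃ i : Fin 3, ∃ y : X, y ≠ 0 ∧ ∀ a : AlgA k, MulOpposite.op a • y =
      MulOpposite.op (algebraMap k (AlgA k) (simpleAlgHom k i a)) • y := by
    by_cases hq : ∃ (x : X) (q : Fin 4), MulOpposite.op (genA k (.ar q)) • x ≠ 0
    · obtain ⟨x, q, hx⟩ := hq
      refine ⟨arrowTgt q, _, hx, fun a => ?_⟩
      rw [smul_smul, smul_smul, ← MulOpposite.op_mul, ← MulOpposite.op_mul, genA_ar_mul,
        ← Algebra.commutes, Algebra.smul_def]
    · push Not at hq
      have := IsSimpleModule.nontrivial (Aop k) X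
      obtain ⟨x, hx⟩ := exists_ne (0 : X)
      have he : ∃ i : Fin 3, MulOpposite.op (genA k (.e i)) • x ≠ 0 := by
        by_contra! hc
        apply hx
        rw [← one_smul (Aop k) x, ← MulOpposite.op_one, ← genA_e_sum, MulOpposite.op_add,
          MulOpposite.op_add, add_smul, add_smul, hc, hc, hc, add_zero, add_zero]
      obtain ⟨i, hi⟩ := he
      refine ⟨i, _, hi, fun a => ?_⟩
      induction a using AlgA.induction with
      | algebraMap c => simp
      | gen g =>
        cases g with
        | e j =>
          rw [smul_smul, ← MulOpposite.op_mul, genA_e_mul_e, simpleAlgHom_genA_e]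
          by_cases hij : i = j
          · simp [hij]
          · simp [hij, Ne.symm hij]
        | ar a => rw [hq]; simp
      | mul a b ha hb =>
        rw [MulOpposite.op_mul, mul_smul, ha, smul_smul, ← MulOpposite.op_mul, Algebra.commutes,
          MulOpposite.op_mul, mul_smul, hb, smul_smul, ← MulOpposite.op_mul,
          ← map_mul (algebraMap k (AlgA k)), map_mul (simpleAlgHom k i) a b,
          mul_comm (simpleAlgHom k i a)]
      | add a b ha hb => rw [MulOpposite.op_add, add_smul, ha, hb, ← add_smul,
          ← MulOpposite.op_add, ← map_add, ← map_add]
  obtain ⟨i, y, hy, hya⟩ := hX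
  have hadd (c d : k) : MulOpposite.op (algebraMap k (AlgA k) (c + d)) • y =
      MulOpposite.op (algebraMap k (AlgA k) c) • y +
        MulOpposite.op (algebraMap k (AlgA k) d) • y := by
    rw [← add_smul, ← MulOpposite.op_add, ← map_add]
  have hsmul (a : Aop k) (c : k) :
      MulOpposite.op (algebraMap k (AlgA k) (simpleAlgHom k i a.unop * c)) • y =
        a • MulOpposite.op (algebraMap k (AlgA k) c) • y := by
    have hcomm : a * MulOpposite.op (algebraMap k (AlgA k) c) =
        MulOpposite.op (algebraMap k (AlgA k) c) * a :=
      MulOpposite.unop_injective (Algebra.commutes c a.unop)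
    have ha : a • y = MulOpposite.op (algebraMap k (AlgA k) (simpleAlgHom k i a.unop)) • y :=
      hya a.unop
    rw [smul_smul, hcomm, mul_smul, ha, smul_smul, ← MulOpposite.op_mul, ← map_mul]
  have hinj (c : k) (hc : MulOpposite.op (algebraMap k (AlgA k) c) • y = 0) : c = 0 := by
    by_contra hne
    apply hy
    have h1 := congrArg (MulOpposite.op (algebraMap k (AlgA k) c⁻¹) • ·) hc
    rw [smul_smul, ← MulOpposite.op_mul, ← map_mul, mul_inv_cancel₀ hne] at h1
    simpa using h1
  let f : SimpleS k i →ₗ[Aop k] X :=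
    { toFun := fun c => MulOpposite.op (algebraMap k (AlgA k) (c : k)) • y
      map_add' := hadd
      map_smul' := hsmul }
  refine ⟨i, ⟨LinearEquiv.ofBijective f ⟨?_, ?_⟩⟩⟩
  · rw [injective_iff_map_eq_zero]
    exact hinj
  · rw [← LinearMap.range_eq_top]
    refine (eq_bot_or_eq_top f.range).resolve_left fun hb => hy ?_
    have h1 : f (1 : k) = 0 := by
      rw [LinearMap.range_eq_bot.1 hb]; rfl
    have h2 : f (1 : k) = MulOpposite.op (algebraMap k (AlgA k) 1) • y := rfl
    rw [h1] at h2
    simpa using h2.symm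

end AlgA

/-- For each vertex `i`, `Ext¹_A(M, S_i) ≠ 0` where `M = A ⊕ D(A)`; consequently no
simple right `A`-module lies in `{X ∈ mod A | Ext¹_A(M, X) = 0}`. -/
theorem ext_one_ma_simple_ne_zero (k : Type) [Field k] :
    (∀ i : Fin 3, Nontrivial (ExtA k (MA k) (SimpleS k i) 1)) ∧
    (∀ (X : Type) [AddCommGroup X] [Module (Aop k) X], Module.Finite (Aop k) X →
        IsSimpleModule (Aop k) X → ¬ Subsingleton (ExtA k (MA k) X 1)) := by
  refine ⟨nontrivial_ext_simpleS, fun X _ _ _ _ hX => ?_⟩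
  obtain ⟨i, ⟨e⟩⟩ := exists_simpleS_equiv (k := k) X
  have : Nontrivial (ExtA k (MA k) (SimpleS k i) 1) := nontrivial_ext_simpleS i
  let F := (Ext ℤ (ModuleCat (Aop k)) 1).obj (op (ModuleCat.of (Aop k) (MA k)))
  let E : ExtA k (MA k) (SimpleS k i) 1 ≃ ExtA k (MA k) X 1 :=
    (F.mapIso e.toModuleIso).toLinearEquiv.toEquiv
  have := E.subsingleton
  exact not_subsingleton (ExtA k (MA k) (SimpleS k i) 1) this
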